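/- arXiv:2301.05485 — 3 statements merged into one kernel-verified Lean document; each statement's English description precedes it below -/
import Mathlib

section
/- Gibbs variational principle (maximum-entropy part of Theorem 1): for every probability distribution p on M satisfying, for each index i, the moment constraint Σ_{m∈M} p(m)·F i m = Σ_{m∈M} p⋆(m)·F i m (i.e. p has the same expectations of all characterizing functions as the Gibbs distribution p⋆), the statistical entropy satisfies S^k(p) ≤ S^k(p⋆). In other words, the Gibbs distribution p⋆ maximizes the statistical entropy among all probability distributions whose expectations of the characterizing functions agree with those of p⋆. -/
/-- The Gibbs inequality: the entropy of `p` is at most its cross-entropy relative to a positive `q`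
of the same total mass. -/
theorem sum_mul_log_le_sum_mul_log_self {M : Type*} [Fintype M] {p q : M → ℝ}
    (hp : ∀ m, 0 ≤ p m) (hq : ∀ m, 0 < q m) (hpq : ∑ m, p m = ∑ m, q m) :
    ∑ m, p m * Real.log (q m) ≤ ∑ m, p m * Real.log (p m) := by
  have key : ∀ m, p m * Real.log (q m) ≤ p m * Real.log (p m) + (q m - p m) := by
    intro m
    rcases (hp m).eq_or_lt with h | h
    · simp [← h, (hq m).le]
    · have hlog := Real.log_le_sub_one_of_pos (div_pos (hq m) h)
      rw [Real.log_div (hq m).ne' h.ne'] at hlog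
      have hmul := mul_le_mul_of_nonneg_left hlog h.le
      have hcancel : p m * (q m / p m - 1) = q m - p m := by field_simp
      linarith
  have hsum := Finset.sum_le_sum fun m (_ : m ∈ Finset.univ) => key m
  rw [Finset.sum_add_distrib, Finset.sum_sub_distrib, hpq] at hsum
  linarith

/-- The expectation of an affine combination of the functions `F i` depends only on the total mass
and the expectations of the `F i`. -/
theorem sum_mul_affine_combination {M ι : Type*} [Fintype M] [Fintype ι]
    (F : ι → M → ℝ) (lam : ι → ℝ) (k c : ℝ) (r : M → ℝ) :
    ∑ m, r m * ((∑ i, lam i * F i m) / k - c) =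
      (∑ i, lam i * ∑ m, r m * F i m) / k - (∑ m, r m) * c := by
  simp only [mul_sub, Finset.sum_sub_distrib, Finset.sum_mul, Finset.mul_sum, Finset.sum_div]
  rw [Finset.sum_comm]
  congr 1
  refine Finset.sum_congr rfl fun i _ => Finset.sum_congr rfl fun m _ => ?_
  ring

/-- Gibbs variational principle (maximum-entropy part of Theorem 1):
among all probability distributions `p` on the finite set `M` whose expectations of
the characterizing functions `F i` agree with those of the Gibbs distribution `pstar`,
the statistical entropy `S^k(p) = -k ∑ p(m) log p(m)` is maximized by `pstar`. -/
theorem gibbs_variational_principle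
    {M ι : Type*} [Fintype M] [Nonempty M] [Fintype ι]
    (k : ℝ) (hk : 0 < k)
    (F : ι → M → ℝ) (lam : ι → ℝ)
    (Z : ℝ) (hZ : Z = ∑ m : M, Real.exp ((∑ i : ι, lam i * F i m) / k))
    (pstar : M → ℝ)
    (hpstar : ∀ m : M, pstar m = Real.exp ((∑ i : ι, lam i * F i m) / k) / Z)
    (p : M → ℝ) (hp0 : ∀ m : M, 0 ≤ p m) (hp1 : ∑ m : M, p m = 1)
    (hmom : ∀ i : ι, ∑ m : M, p m * F i m = ∑ m : M, pstar m * F i m) :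
    -k * ∑ m : M, p m * Real.log (p m) ≤
      -k * ∑ m : M, pstar m * Real.log (pstar m) := by
  have hZpos : 0 < Z := hZ ▸ Finset.sum_pos (fun m _ => Real.exp_pos _) Finset.univ_nonempty
  have hpos : ∀ m, 0 < pstar m := fun m => hpstar m ▸ div_pos (Real.exp_pos _) hZpos
  have hsum : ∑ m, pstar m = 1 := by
    simp only [hpstar]
    rw [← Finset.sum_div, ← hZ, div_self hZpos.ne']
  have hlog : ∀ m, Real.log (pstar m) = (∑ i, lam i * F i m) / k - Real.log Z := fun m => by
    rw [hpstar, Real.log_div (Real.exp_pos _).ne' hZpos.ne', Real.log_exp]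
  have hcross : ∑ m, p m * Real.log (pstar m) = ∑ m, pstar m * Real.log (pstar m) := by
    simp only [hlog, sum_mul_affine_combination, hmom, hp1, hsum]
  have hgibbs := sum_mul_log_le_sum_mul_log_self hp0 hpos (hp1.trans hsum.symm)
  rw [hcross] at hgibbs
  exact mul_le_mul_of_nonpos_left hgibbs (neg_nonpos.mpr hk.le)
end

section
/- Uniqueness in the Gibbs variational principle (equality case of Theorem 1): if p is a probability distribution on M satisfying, for each index i, the moment constraint Σ_{m∈M} p(m)·F i m = Σ_{m∈M} p⋆(m)·F i m, and if moreover S^k(p) = S^k(p⋆), then p = p⋆, i.e. p(m) = p⋆(m) for every m ∈ M. -/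
open InformationTheory in
/-- Equality case of the Gibbs inequality on a finite type. -/
lemma eq_of_sum_mul_log_eq_sum_mul_log {M : Type*} [Fintype M] {p q : M → ℝ}
    (hp : ∀ m, 0 ≤ p m) (hq : ∀ m, 0 < q m) (hsum : ∑ m, p m = ∑ m, q m)
    (hlog : ∑ m, p m * Real.log (p m) = ∑ m, p m * Real.log (q m)) (m : M) :
    p m = q m := by
  have hterm (m : M) : q m * klFun (p m / q m) =
      p m * Real.log (p m) - p m * Real.log (q m) + (q m - p m) := by
    have hqm := (hq m).ne'
    rcases eq_or_ne (p m) 0 with h | h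
    · simp [h, klFun_zero]
    · rw [klFun_apply, Real.log_div h hqm]
      field_simp
      ring
  have hzero : ∑ m, q m * klFun (p m / q m) = 0 := by
    simp only [hterm, Finset.sum_add_distrib, Finset.sum_sub_distrib]
    linarith
  have hnonneg (m : M) : 0 ≤ p m / q m := div_nonneg (hp m) (hq m).le
  have hm := (Finset.sum_eq_zero_iff_of_nonneg fun m _ =>
    mul_nonneg (hq m).le (klFun_nonneg (hnonneg m))).mp hzero m (Finset.mem_univ m)
  have hkl := (mul_eq_zero.mp hm).resolve_left (hq m).ne'
  rwa [klFun_eq_zero_iff (hnonneg m), div_eq_one_iff_eq (hq m).ne'] at hkl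

/-- Uniqueness in the Gibbs variational principle (equality case of Theorem 1):
if a probability distribution `p` on `M` has the same expectations of the
characterizing functions as the Gibbs distribution `pstar`, and the statistical
entropies coincide, then `p = pstar` pointwise. -/
theorem gibbs_variational_principle_uniqueness
    {M ι : Type*} [Fintype M] [Nonempty M] [Fintype ι]
    (k : ℝ) (hk : 0 < k)
    (F : ι → M → ℝ) (lam : ι → ℝ)
    (Z : ℝ) (hZ : Z = ∑ m : M, Real.exp ((∑ i : ι, lam i * F i m) / k))
    (pstar : M → ℝ)
    (hpstar : ∀ m : M, pstar m = Real.exp ((∑ i : ι, lam i * F i m) / k) / Z)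
    (p : M → ℝ) (hp0 : ∀ m : M, 0 ≤ p m) (hp1 : ∑ m : M, p m = 1)
    (hmom : ∀ i : ι, ∑ m : M, p m * F i m = ∑ m : M, pstar m * F i m)
    (hent : -k * ∑ m : M, p m * Real.log (p m) =
      -k * ∑ m : M, pstar m * Real.log (pstar m)) :
    ∀ m : M, p m = pstar m := by
  have hZpos : 0 < Z := hZ ▸ Finset.sum_pos (fun m _ => Real.exp_pos _) Finset.univ_nonempty
  have hpos (m : M) : 0 < pstar m := hpstar m ▸ div_pos (Real.exp_pos _) hZpos
  have hsum : ∑ m, pstar m = 1 := by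
    simp only [hpstar, ← Finset.sum_div, ← hZ]
    exact div_self hZpos.ne'
  have hlog (m : M) : Real.log (pstar m) = (∑ i, lam i * F i m) / k - Real.log Z := by
    rw [hpstar, Real.log_div (Real.exp_ne_zero _) hZpos.ne', Real.log_exp]
  have hexpand (r : M → ℝ) (hr : ∑ m, r m = 1) :
      ∑ m, r m * Real.log (pstar m) =
        (∑ i, lam i * ∑ m, r m * F i m) / k - Real.log Z := by
    simp only [hlog, mul_sub, Finset.sum_sub_distrib, ← Finset.sum_mul, hr, one_mul,
      mul_div_assoc', ← Finset.sum_div, Finset.mul_sum]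
    rw [Finset.sum_comm]
    simp only [mul_left_comm]
  refine eq_of_sum_mul_log_eq_sum_mul_log hp0 hpos (hp1.trans hsum.symm) ?_
  rw [mul_left_cancel₀ (neg_ne_zero.mpr hk.ne') hent, hexpand p hp1, hexpand pstar hsum]
  simp only [hmom]
end

section
/- Legendre-transform property of the thermodynamic entropy (Property 3 / Eq. (26)): the statistical entropy of the Gibbs distribution equals S^k(p⋆) = k·ln Z(λ) − Σ_{i∈ι} λ i · (Σ_{m∈M} p⋆(m)·F i m), i.e. the thermodynamic entropy is k·ln Z minus the sum over i of λ_i times the expectation of F_i under the Gibbs distribution. -/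
/-- Legendre-transform property of the thermodynamic entropy (Property 3 / Eq. (26)):
the statistical entropy of the Gibbs distribution equals
`k ln Z(λ) - ∑ i, λ i * E_{p⋆}[F i]`. -/
theorem thermodynamic_entropy_legendre
    {M ι : Type*} [Fintype M] [Nonempty M] [Fintype ι]
    (k : ℝ) (hk : 0 < k)
    (F : ι → M → ℝ) (lam : ι → ℝ)
    (Z : ℝ) (hZ : Z = ∑ m : M, Real.exp ((∑ i : ι, lam i * F i m) / k))
    (pstar : M → ℝ)
    (hpstar : ∀ m : M, pstar m = Real.exp ((∑ i : ι, lam i * F i m) / k) / Z) :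
    -k * ∑ m : M, pstar m * Real.log (pstar m) =
      k * Real.log Z - ∑ i : ι, lam i * ∑ m : M, pstar m * F i m := by
  have hZpos : 0 < Z := hZ ▸ Finset.sum_pos (fun m _ => Real.exp_pos _) Finset.univ_nonempty
  have hsum : ∑ m : M, pstar m = 1 := by
    simp_rw [hpstar]
    rw [← Finset.sum_div, ← hZ, div_self hZpos.ne']
  have hlog (m : M) : k * Real.log (pstar m) = ∑ i : ι, lam i * F i m - k * Real.log Z := by
    rw [hpstar, Real.log_div (Real.exp_pos _).ne' hZpos.ne', Real.log_exp, mul_sub,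
      mul_div_cancel₀ _ hk.ne']
  have hswap : ∑ i : ι, lam i * ∑ m : M, pstar m * F i m =
      ∑ m : M, pstar m * ∑ i : ι, lam i * F i m := by
    simp_rw [Finset.mul_sum, mul_left_comm (lam _)]
    exact Finset.sum_comm
  calc -k * ∑ m : M, pstar m * Real.log (pstar m)
      = -∑ m : M, pstar m * (k * Real.log (pstar m)) := by
        simp_rw [mul_left_comm _ k, ← Finset.mul_sum, neg_mul]
    _ = (∑ m : M, pstar m) * (k * Real.log Z) - ∑ m : M, pstar m * ∑ i : ι, lam i * F i m := by
        simp_rw [hlog, mul_sub, Finset.sum_sub_distrib, ← Finset.sum_mul, neg_sub]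
    _ = k * Real.log Z - ∑ i : ι, lam i * ∑ m : M, pstar m * F i m := by
        rw [hsum, one_mul, hswap]
end
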